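/- arXiv:2601.02142 — 2 statements merged into one kernel-verified Lean document; each statement's English description precedes it below -/
import Mathlib

section
/- Let 0 < α < 1 and let v ∈ 𝓢(ℝ) be a Schwartz function. Define the Weyl–Marchaud derivative (D^α v)(x) := c_α ∫_0^∞ (v(x) − v(x − s)) s^{−1−α} ds with c_α = α/Γ(1−α) (the integral converges absolutely). Then for every ξ ∈ ℝ, the unitary Fourier transform satisfies (2π)^{-1/2} ∫_ℝ (D^α v)(x) e^{−iξx} dx = (iξ)^α · (2π)^{-1/2} ∫_ℝ v(x) e^{−iξx} dx, where (iξ)^α = |ξ|^α e^{iαπ·sgn(ξ)/2} is the principal branch. -/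
open MeasureTheory Set Filter

noncomputable section

/-- The classical Weyl–Marchaud fractional derivative of order `α`. -/
def marchaud (α : ℝ) (v : ℝ → ℂ) (x : ℝ) : ℂ :=
  ((α / Real.Gamma (1 - α) : ℝ) : ℂ) *
    ∫ s in Set.Ioi (0 : ℝ), (v x - v (x - s)) * ((s ^ (-1 - α) : ℝ) : ℂ)

open scoped Topology

/-- The weight `min 1 s * s ^ (-1 - α)` is integrable on the half line when `0 < α < 1`. -/
lemma integrableOn_min_one_mul_rpow {α : ℝ} (hα : 0 < α) (hα1 : α < 1) :
    IntegrableOn (fun s : ℝ => min 1 s * s ^ (-1 - α)) (Ioi 0) := by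
  rw [← Ioc_union_Ioi_eq_Ioi zero_le_one]
  refine IntegrableOn.union ?_ ?_
  · have h : IntegrableOn (fun s : ℝ => s ^ (-α)) (Ioc 0 1) :=
      (intervalIntegrable_iff_integrableOn_Ioc_of_le zero_le_one).1
        (intervalIntegral.intervalIntegrable_rpow' (by linarith))
    refine h.congr_fun (fun s hs => ?_) measurableSet_Ioc
    have h0 : 0 < s := hs.1
    simp only [min_eq_right hs.2]
    rw [show -α = 1 + (-1 - α) by ring, Real.rpow_add h0, Real.rpow_one]
  · have h : IntegrableOn (fun s : ℝ => s ^ (-1 - α)) (Ioi 1) :=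
      integrableOn_Ioi_rpow_of_lt (by linarith) zero_lt_one
    refine h.congr_fun (fun s hs => ?_) measurableSet_Ioi
    simp [min_eq_left (le_of_lt (mem_Ioi.1 hs))]

lemma norm_mul_ofReal_rpow_le {c : ℂ} {K s p : ℝ} (hs : 0 < s) (h : ‖c‖ ≤ K * min 1 s) :
    ‖c * ((s ^ p : ℝ) : ℂ)‖ ≤ K * (min 1 s * s ^ p) := by
  have hp : 0 ≤ s ^ p := Real.rpow_nonneg hs.le _
  rw [norm_mul, Complex.norm_real, Real.norm_of_nonneg hp, ← mul_assoc]
  gcongr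

lemma integrableOn_mul_rpow_of_norm_le {α : ℝ} (hα : 0 < α) (hα1 : α < 1) {f : ℝ → ℂ}
    (hf : Measurable f) {K : ℝ} (hK : ∀ s, 0 < s → ‖f s‖ ≤ K * min 1 s) :
    IntegrableOn (fun s : ℝ => f s * ((s ^ (-1 - α) : ℝ) : ℂ)) (Ioi 0) := by
  refine Integrable.mono' ((integrableOn_min_one_mul_rpow hα hα1).const_mul K)
    (by fun_prop) ?_
  filter_upwards [ae_restrict_mem measurableSet_Ioi] with s hs
  exact norm_mul_ofReal_rpow_le hs (hK s hs)

lemma norm_one_sub_exp_neg_mul_le {z : ℂ} (hz : 0 ≤ z.re) {s : ℝ} (hs : 0 < s) :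
    ‖1 - Complex.exp (-(z * s))‖ ≤ 2 * (1 + ‖z‖) * min 1 s := by
  have h2 : ‖1 - Complex.exp (-(z * s))‖ ≤ 2 := by
    refine (norm_sub_le _ _).trans ?_
    have : ‖Complex.exp (-(z * s))‖ ≤ 1 := by
      rw [Complex.norm_exp, Real.exp_le_one_iff]
      simpa using mul_nonneg hz hs.le
    simpa using by linarith
  have h1 : ‖1 - Complex.exp (-(z * s))‖ ≤ 2 * (‖z‖ * s) := by
    have hn : ‖-(z * (s : ℂ))‖ = ‖z‖ * s := by simp [abs_of_pos hs]
    by_cases h : ‖z‖ * s ≤ 1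
    · rw [norm_sub_rev, ← hn]
      exact Complex.norm_exp_sub_one_le (hn.trans_le h)
    · linarith
  have hz0 := norm_nonneg z
  rcases min_cases 1 s with ⟨h, -⟩ | ⟨h, -⟩ <;> rw [h] <;> nlinarith

lemma integrableOn_rpow_neg_mul_exp_neg_mul {α r : ℝ} (hα1 : α < 1) (hr : 0 < r) :
    IntegrableOn (fun s : ℝ => s ^ (-α) * Real.exp (-(r * s))) (Ioi 0) := by
  simpa using integrableOn_rpow_mul_exp_neg_mul_rpow (s := -α) (p := 1) (b := r)
    (by linarith) one_pos hr

lemma integral_one_sub_exp_neg_mul_rpow {α : ℝ} (hα : 0 < α) (hα1 : α < 1) {r : ℝ} (hr : 0 < r) :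
    ∫ s in Ioi (0 : ℝ), (1 - Complex.exp (-((r : ℂ) * s))) * ((s ^ (-1 - α) : ℝ) : ℂ) =
      ((Real.Gamma (1 - α) / α * r ^ α : ℝ) : ℂ) := by
  have hcast : ∀ s : ℝ, (1 - Complex.exp (-((r : ℂ) * s))) * ((s ^ (-1 - α) : ℝ) : ℂ) =
      (((1 - Real.exp (-(r * s))) * s ^ (-1 - α) : ℝ) : ℂ) := fun s => by push_cast; rfl
  have hint : IntegrableOn (fun s : ℝ => (1 - Real.exp (-(r * s))) * s ^ (-1 - α)) (Ioi 0) := by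
    have h := integrableOn_mul_rpow_of_norm_le hα hα1
      (f := fun s => 1 - Complex.exp (-((r : ℂ) * s))) (by fun_prop)
      (fun s hs => norm_one_sub_exp_neg_mul_le (z := r) (by simpa using hr.le) hs)
    simp only [hcast] at h
    exact h.re
  have hint2 : IntegrableOn (fun s : ℝ => s ^ (-α) * Real.exp (-(r * s))) (Ioi 0) :=
    integrableOn_rpow_neg_mul_exp_neg_mul hα1 hr
  have hΓ : ∫ s in Ioi (0 : ℝ), s ^ (-α) * Real.exp (-(r * s)) =
      (1 / r) ^ (1 - α) * Real.Gamma (1 - α) := by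
    rw [← Real.integral_rpow_mul_exp_neg_mul_Ioi (by linarith) hr]
    simp
  have hbp : ∫ s in Ioi (0 : ℝ), (r * (s ^ (-α) * Real.exp (-(r * s))) -
      α * ((1 - Real.exp (-(r * s))) * s ^ (-1 - α))) =
      0 - (1 - Real.exp (-(r * 0))) * (0 : ℝ) ^ (-α) := by
    refine integral_Ioi_of_hasDerivAt_of_tendsto
      (f := fun s : ℝ => (1 - Real.exp (-(r * s))) * s ^ (-α)) ?_ ?_
      ((hint2.const_mul r).sub (hint.const_mul α)) ?_
    · have hlim : Tendsto (fun s : ℝ => r * s ^ (1 - α)) (𝓝[Ici 0] 0) (𝓝 0) := by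
        have : ContinuousAt (fun s : ℝ => r * s ^ (1 - α)) 0 :=
          continuousAt_const.mul (Real.continuousAt_rpow_const _ _ (Or.inr (by linarith)))
        have h := this.tendsto
        simp only [Real.zero_rpow (by linarith : 1 - α ≠ 0), mul_zero] at h
        exact h.mono_left nhdsWithin_le_nhds
      have : Tendsto (fun s : ℝ => (1 - Real.exp (-(r * s))) * s ^ (-α)) (𝓝[Ici 0] 0) (𝓝 0) := by
        refine squeeze_zero_norm' ?_ hlim
        filter_upwards [self_mem_nhdsWithin] with s hs
        rcases eq_or_lt_of_le (mem_Ici.1 hs) with rfl | hs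
        · simp [Real.zero_rpow (by linarith : 1 - α ≠ 0)]
        have h1 : Real.exp (-(r * s)) ≤ 1 := by
          rw [Real.exp_le_one_iff]; nlinarith
        have h2 := Real.add_one_le_exp (-(r * s))
        have h3 : 0 ≤ s ^ (-α) := Real.rpow_nonneg hs.le _
        rw [Real.norm_of_nonneg (mul_nonneg (by linarith) h3),
          show 1 - α = 1 + -α by ring, Real.rpow_add hs, Real.rpow_one, ← mul_assoc]
        gcongr
        linarith
      simpa [ContinuousWithinAt] using this
    · intro s hs
      have hs : 0 < s := hs
      have h1 : HasDerivAt (fun s : ℝ => 1 - Real.exp (-(r * s)))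
          (-(Real.exp (-(r * s)) * (-(r * 1)))) s :=
        (((hasDerivAt_id s).const_mul r).neg.exp).const_sub 1
      have h2 := Real.hasDerivAt_rpow_const (x := s) (p := -α) (Or.inl hs.ne')
      convert! h1.mul h2 using 1
      rw [show -α - 1 = -1 - α by ring]
      ring
    · refine squeeze_zero_norm' ?_ (tendsto_rpow_neg_atTop hα)
      filter_upwards [eventually_gt_atTop 0] with s hs
      have h1 : Real.exp (-(r * s)) ≤ 1 := by
        rw [Real.exp_le_one_iff]; nlinarith
      have h3 : 0 ≤ s ^ (-α) := Real.rpow_nonneg hs.le _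
      rw [Real.norm_of_nonneg (mul_nonneg (by linarith) h3)]
      nlinarith [Real.exp_pos (-(r * s))]
  rw [integral_sub (hint2.const_mul r) (hint.const_mul α), integral_const_mul,
    integral_const_mul, hΓ] at hbp
  have hr' : r * (1 / r) ^ (1 - α) = r ^ α := by
    rw [one_div, Real.inv_rpow hr.le, ← Real.rpow_neg hr.le]
    nth_rw 1 [← Real.rpow_one r]
    rw [← Real.rpow_add hr]
    congr 1
    ring
  simp only [hcast, integral_complex_ofReal]
  congr 1
  simp only [mul_zero, neg_zero, Real.exp_zero, sub_self, zero_mul] at hbp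
  rw [← mul_assoc, hr'] at hbp
  field_simp
  linarith

/-- The integral `∫₀^∞ (1 - exp (-z s)) s ^ (-1 - α) ds`. -/
def oneSubExpIntegral (α : ℝ) (z : ℂ) : ℂ :=
  ∫ s in Ioi (0 : ℝ), (1 - Complex.exp (-(z * s))) * ((s ^ (-1 - α) : ℝ) : ℂ)

lemma differentiableAt_oneSubExpIntegral {α : ℝ} (hα : 0 < α) (hα1 : α < 1) {z₀ : ℂ}
    (hz₀ : 0 < z₀.re) : DifferentiableAt ℂ (oneSubExpIntegral α) z₀ := by
  have hU : {z : ℂ | z₀.re / 2 < z.re} ∈ 𝓝 z₀ :=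
    (isOpen_lt continuous_const Complex.continuous_re).mem_nhds (by simp; linarith)
  refine (hasDerivAt_integral_of_dominated_loc_of_deriv_le (𝕜 := ℂ)
    (F' := fun z (s : ℝ) => s * Complex.exp (-(z * s)) * ((s ^ (-1 - α) : ℝ) : ℂ))
    (bound := fun s : ℝ => s ^ (-α) * Real.exp (-(z₀.re / 2 * s))) hU
    (.of_forall fun z => by fun_prop) ?_ (by fun_prop) ?_ ?_ ?_).2.differentiableAt
  · exact integrableOn_mul_rpow_of_norm_le hα hα1 (by fun_prop)
      (fun s hs => norm_one_sub_exp_neg_mul_le hz₀.le hs)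
  · filter_upwards [ae_restrict_mem measurableSet_Ioi] with s hs z hz
    have hs : 0 < s := hs
    have hz : z₀.re / 2 < z.re := hz
    have hp : 0 ≤ s ^ (-1 - α) := Real.rpow_nonneg hs.le _
    rw [norm_mul, norm_mul, Complex.norm_real, Complex.norm_real, Real.norm_of_nonneg hp,
      Real.norm_of_nonneg hs.le, Complex.norm_exp, show -α = 1 + (-1 - α) by ring,
      Real.rpow_add hs, Real.rpow_one, mul_right_comm]
    gcongr
    simpa using by nlinarith
  · exact integrableOn_rpow_neg_mul_exp_neg_mul hα1 (by linarith)
  · refine .of_forall fun s z _ => ?_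
    have h : HasDerivAt (fun z : ℂ => 1 - Complex.exp (-(z * s)))
        (-(Complex.exp (-(z * s)) * (-(1 * (s : ℂ))))) z :=
      (((hasDerivAt_id z).mul_const (s : ℂ)).neg.cexp).const_sub 1
    convert! h.mul_const ((s ^ (-1 - α) : ℝ) : ℂ) using 1
    ring

lemma oneSubExpIntegral_eq_of_re_pos {α : ℝ} (hα : 0 < α) (hα1 : α < 1) {z : ℂ}
    (hz : 0 < z.re) :
    oneSubExpIntegral α z = ((Real.Gamma (1 - α) / α : ℝ) : ℂ) * z ^ (α : ℂ) := by
  have hopen : IsOpen {z : ℂ | 0 < z.re} := isOpen_lt continuous_const Complex.continuous_re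
  have hf : AnalyticOnNhd ℂ (oneSubExpIntegral α) {z : ℂ | 0 < z.re} :=
    DifferentiableOn.analyticOnNhd (fun w hw =>
      (differentiableAt_oneSubExpIntegral hα hα1 hw).differentiableWithinAt) hopen
  have hg : AnalyticOnNhd ℂ
      (fun z : ℂ => ((Real.Gamma (1 - α) / α : ℝ) : ℂ) * z ^ (α : ℂ)) {z : ℂ | 0 < z.re} :=
    fun w hw => analyticAt_const.mul (analyticAt_id.cpow analyticAt_const (Or.inl hw))
  refine hf.eqOn_of_preconnected_of_frequently_eq hg
    (convex_halfSpace_re_gt 0).isPreconnected (z₀ := 1) (by simp) ?_ hz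
  have htend : Tendsto (fun r : ℝ => (r : ℂ)) (𝓝[≠] 1) (𝓝[≠] 1) := by
    refine tendsto_nhdsWithin_iff.2 ⟨?_, ?_⟩
    · exact (Complex.continuous_ofReal.tendsto' 1 1 (by simp)).mono_left nhdsWithin_le_nhds
    · filter_upwards [self_mem_nhdsWithin] with r hr
      simpa using hr
  refine htend.frequently (Eventually.frequently ?_)
  filter_upwards [nhdsWithin_le_nhds (lt_mem_nhds one_pos)] with r hr
  rw [oneSubExpIntegral, integral_one_sub_exp_neg_mul_rpow hα hα1 hr]
  push_cast
  rw [Complex.ofReal_cpow (le_of_lt hr)]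

lemma oneSubExpIntegral_I_mul {α : ℝ} (hα : 0 < α) (hα1 : α < 1) (ξ : ℝ) :
    oneSubExpIntegral α (Complex.I * ξ) =
      ((Real.Gamma (1 - α) / α : ℝ) : ℂ) * (Complex.I * ξ) ^ (α : ℂ) := by
  rcases eq_or_ne ξ 0 with rfl | hξ
  · simp [oneSubExpIntegral, hα.ne']
  have hpath : Tendsto (fun ε : ℝ => Complex.I * ξ + (ε : ℂ)) (𝓝[>] 0) (𝓝 (Complex.I * ξ)) :=
    (Continuous.tendsto' (by fun_prop) _ _ (by simp)).mono_left nhdsWithin_le_nhds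
  have hpow : Tendsto (fun ε : ℝ => ((Real.Gamma (1 - α) / α : ℝ) : ℂ) *
      (Complex.I * ξ + (ε : ℂ)) ^ (α : ℂ)) (𝓝[>] 0)
      (𝓝 (((Real.Gamma (1 - α) / α : ℝ) : ℂ) * (Complex.I * ξ) ^ (α : ℂ))) := by
    have hc : ContinuousAt (fun z : ℂ => z ^ (α : ℂ)) (Complex.I * ξ) :=
      continuousAt_cpow_const (Or.inr (by simpa using hξ))
    exact (hc.tendsto.comp hpath).const_mul _
  have hI : Tendsto (fun ε : ℝ => oneSubExpIntegral α (Complex.I * ξ + (ε : ℂ))) (𝓝[>] 0)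
      (𝓝 (oneSubExpIntegral α (Complex.I * ξ))) := by
    refine tendsto_integral_filter_of_dominated_convergence
      (fun s => 2 * (1 + (|ξ| + 1)) * (min 1 s * s ^ (-1 - α)))
      (.of_forall fun ε => by fun_prop) ?_
      ((integrableOn_min_one_mul_rpow hα hα1).const_mul _) ?_
    · filter_upwards [Ioc_mem_nhdsGT (one_pos : (0 : ℝ) < 1)] with ε hε
      filter_upwards [ae_restrict_mem measurableSet_Ioi] with s hs
      have hs : 0 < s := hs
      refine norm_mul_ofReal_rpow_le hs ?_
      refine (norm_one_sub_exp_neg_mul_le (by simpa using hε.1.le) hs).trans ?_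
      gcongr
      refine (norm_add_le _ _).trans ?_
      simpa [abs_of_pos hε.1] using hε.2
    · refine .of_forall fun s => ?_
      have : Continuous fun z : ℂ => (1 - Complex.exp (-(z * s))) * ((s ^ (-1 - α) : ℝ) : ℂ) := by
        fun_prop
      exact (this.tendsto _).comp hpath
  refine tendsto_nhds_unique hI (hpow.congr' ?_)
  filter_upwards [self_mem_nhdsWithin] with ε hε
  exact (oneSubExpIntegral_eq_of_re_pos hα hα1 (by simpa using hε)).symm

lemma exists_norm_sub_comp_sub_le_inv_one_add_sq (v : SchwartzMap ℝ ℂ) :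
    ∃ C : ℝ, 0 ≤ C ∧ ∀ x s : ℝ, 0 < s → s ≤ 1 → ‖v x - v (x - s)‖ ≤ C * (1 + x ^ 2)⁻¹ * s := by
  obtain ⟨A, hA, hA'⟩ := (SchwartzMap.derivCLM ℂ ℂ v).decay 0 0
  obtain ⟨B, hB, hB'⟩ := (SchwartzMap.derivCLM ℂ ℂ v).decay 2 0
  simp only [norm_iteratedFDeriv_zero, SchwartzMap.derivCLM_apply, pow_zero, one_mul,
    Real.norm_eq_abs, sq_abs] at hA' hB'
  refine ⟨3 * (A + B), by positivity, fun x s hs hs1 => ?_⟩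
  have hbound : ∀ y ∈ Icc (x - s) x, ‖deriv v y‖ ≤ 3 * (A + B) * (1 + x ^ 2)⁻¹ := by
    intro y hy
    rw [← div_eq_mul_inv, le_div_iff₀ (by positivity)]
    have h1 : 1 + x ^ 2 ≤ 3 * (1 + y ^ 2) := by
      have h2 : (x - y) ^ 2 ≤ 1 := by
        rw [sq_le_one_iff_abs_le_one, abs_le]
        constructor <;> linarith [hy.1, hy.2]
      nlinarith [sq_nonneg (x - 2 * y)]
    calc ‖deriv v y‖ * (1 + x ^ 2) ≤ ‖deriv v y‖ * (3 * (1 + y ^ 2)) := by gcongr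
      _ ≤ 3 * (A + B) := by linarith [hA' y, hB' y]
  have h := (convex_Icc (x - s) x).norm_image_sub_le_of_norm_deriv_le
    (fun y _ => v.differentiableAt) hbound (left_mem_Icc.2 (by linarith))
    (right_mem_Icc.2 (by linarith))
  simpa [abs_of_pos hs] using h

lemma exists_norm_sub_comp_sub_le (v : SchwartzMap ℝ ℂ) :
    ∃ K : ℝ, ∀ x s : ℝ, 0 < s → ‖v x - v (x - s)‖ ≤ K * min 1 s := by
  obtain ⟨C, hC, hv⟩ := exists_norm_sub_comp_sub_le_inv_one_add_sq v
  obtain ⟨M, hM, hM'⟩ := v.decay 0 0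
  simp only [norm_iteratedFDeriv_zero, pow_zero, one_mul] at hM'
  refine ⟨C + 2 * M, fun x s hs => ?_⟩
  rcases le_total s 1 with h | h
  · rw [min_eq_right h]
    refine (hv x s hs h).trans ?_
    gcongr
    have : (1 + x ^ 2)⁻¹ ≤ 1 := inv_le_one_of_one_le₀ (by nlinarith)
    nlinarith
  · rw [min_eq_left h]
    linarith [norm_sub_le (v x) (v (x - s)), hM' x, hM' (x - s)]

lemma exists_integral_norm_sub_comp_sub_le (v : SchwartzMap ℝ ℂ) :
    ∃ K : ℝ, ∀ s : ℝ, 0 < s → ∫ x, ‖v x - v (x - s)‖ ≤ K * min 1 s := by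
  obtain ⟨C, hC, hv⟩ := exists_norm_sub_comp_sub_le_inv_one_add_sq v
  have hvi : Integrable (fun x => v x) := v.integrable
  refine ⟨C * Real.pi + 2 * ∫ x, ‖v x‖, fun s hs => ?_⟩
  have hvs : Integrable (fun x => v (x - s)) := hvi.comp_sub_right s
  have h0 : 0 ≤ ∫ x, ‖v x‖ := integral_nonneg fun _ => norm_nonneg _
  rcases le_total s 1 with h | h
  · rw [min_eq_right h]
    calc ∫ x, ‖v x - v (x - s)‖ ≤ ∫ x, C * (1 + x ^ 2)⁻¹ * s :=
          integral_mono (hvi.sub hvs).norm ((integrable_inv_one_add_sq.const_mul C).mul_const s)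
            fun x => hv x s hs h
      _ = C * Real.pi * s := by
          rw [integral_mul_const, integral_const_mul, integral_univ_inv_one_add_sq]
      _ ≤ _ := by gcongr; linarith
  · rw [min_eq_left h]
    calc ∫ x, ‖v x - v (x - s)‖ ≤ ∫ x, (‖v x‖ + ‖v (x - s)‖) :=
          integral_mono (hvi.sub hvs).norm (hvi.norm.add hvs.norm) fun x => norm_sub_le _ _
      _ = 2 * ∫ x, ‖v x‖ := by
          rw [integral_add hvi.norm hvs.norm, integral_sub_right_eq_self (fun x => ‖v x‖) s]
          ring
      _ ≤ _ := by nlinarith [Real.pi_pos]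

lemma norm_exp_neg_I_mul (ξ x : ℝ) : ‖Complex.exp (-(Complex.I * ξ * x))‖ = 1 := by
  simp [Complex.norm_exp]

lemma integrable_mul_exp_neg_I_mul {f : ℝ → ℂ} (hf : Integrable f) (ξ : ℝ) :
    Integrable fun x : ℝ => f x * Complex.exp (-(Complex.I * ξ * x)) :=
  hf.mul_bdd (c := 1) (by fun_prop) (.of_forall fun x => (norm_exp_neg_I_mul ξ x).le)

lemma integrable_marchaud_integrand_prod {α : ℝ} (hα : 0 < α) (hα1 : α < 1)
    (v : SchwartzMap ℝ ℂ) (ξ : ℝ) :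
    Integrable (Function.uncurry fun x s : ℝ => (v x - v (x - s)) * ((s ^ (-1 - α) : ℝ) : ℂ) *
      Complex.exp (-(Complex.I * ξ * x))) (volume.prod (volume.restrict (Ioi 0))) := by
  have hvc : Continuous v := v.continuous
  have hvi : Integrable (fun x => v x) := v.integrable
  have hmeas : Measurable fun p : ℝ × ℝ => (v p.1 - v (p.1 - p.2)) *
      ((p.2 ^ (-1 - α) : ℝ) : ℂ) * Complex.exp (-(Complex.I * ξ * p.1)) := by
    fun_prop
  have hsec : ∀ s : ℝ, Integrable fun x : ℝ => (v x - v (x - s)) * ((s ^ (-1 - α) : ℝ) : ℂ) *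
      Complex.exp (-(Complex.I * ξ * x)) := by
    intro s
    have h : Integrable fun x : ℝ => v x - v (x - s) := hvi.sub (hvi.comp_sub_right s)
    exact integrable_mul_exp_neg_I_mul (h.mul_const _) ξ
  rw [Function.uncurry_def, integrable_prod_iff' hmeas.aestronglyMeasurable]
  refine ⟨.of_forall hsec, ?_⟩
  obtain ⟨K, hK⟩ := exists_integral_norm_sub_comp_sub_le v
  refine Integrable.mono' ((integrableOn_min_one_mul_rpow hα hα1).const_mul K)
    hmeas.norm.stronglyMeasurable.integral_prod_left'.aestronglyMeasurable ?_
  filter_upwards [ae_restrict_mem measurableSet_Ioi] with s hs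
  have hs : 0 < s := hs
  have hp : 0 ≤ s ^ (-1 - α) := Real.rpow_nonneg hs.le _
  simp only [norm_mul, norm_exp_neg_I_mul, mul_one,
    Complex.norm_real, Real.norm_of_nonneg hp, integral_mul_const]
  rw [Real.norm_of_nonneg (integral_nonneg fun _ => norm_nonneg _), ← mul_assoc]
  exact mul_le_mul_of_nonneg_right (hK s hs) hp

lemma integral_sub_comp_sub_mul_exp (v : SchwartzMap ℝ ℂ) (ξ s : ℝ) :
    ∫ x : ℝ, (v x - v (x - s)) * Complex.exp (-(Complex.I * ξ * x)) =
      (1 - Complex.exp (-(Complex.I * ξ * s))) *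
        ∫ x : ℝ, v x * Complex.exp (-(Complex.I * ξ * x)) := by
  have hvi : Integrable (fun x => v x) := v.integrable
  have hshift : ∫ x : ℝ, v (x - s) * Complex.exp (-(Complex.I * ξ * x)) =
      Complex.exp (-(Complex.I * ξ * s)) *
        ∫ x : ℝ, v x * Complex.exp (-(Complex.I * ξ * x)) := by
    rw [← integral_const_mul, ← integral_sub_right_eq_self (μ := volume) (fun x : ℝ =>
      Complex.exp (-(Complex.I * ξ * s)) * (v x * Complex.exp (-(Complex.I * ξ * x)))) s]
    refine integral_congr_ae (.of_forall fun x => ?_)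
    simp only
    rw [mul_left_comm, ← Complex.exp_add]
    congr 2
    push_cast
    ring
  simp only [sub_mul, one_mul]
  rw [integral_sub (integrable_mul_exp_neg_I_mul hvi ξ)
    (integrable_mul_exp_neg_I_mul (hvi.comp_sub_right s) ξ), hshift]

theorem stmt_10
    (α : ℝ) (hα : 0 < α) (hα1 : α < 1)
    (v : SchwartzMap ℝ ℂ) :
    -- the Marchaud integral converges absolutely
    (∀ x : ℝ, IntegrableOn
      (fun s : ℝ => (v x - v (x - s)) * ((s ^ (-1 - α) : ℝ) : ℂ)) (Set.Ioi (0 : ℝ))) ∧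
    -- the unitary Fourier transform diagonalizes it
    (∀ ξ : ℝ,
      (Real.sqrt (2 * Real.pi) : ℂ)⁻¹ *
          (∫ x : ℝ, marchaud α (fun y => v y) x * Complex.exp (-(Complex.I * (ξ : ℂ) * (x : ℂ)))) =
        (Complex.I * (ξ : ℂ)) ^ (α : ℂ) *
          ((Real.sqrt (2 * Real.pi) : ℂ)⁻¹ *
            ∫ x : ℝ, v x * Complex.exp (-(Complex.I * (ξ : ℂ) * (x : ℂ))))) := by
  refine ⟨fun x => ?_, fun ξ => ?_⟩
  · obtain ⟨K, hK⟩ := exists_norm_sub_comp_sub_le v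
    exact integrableOn_mul_rpow_of_norm_le hα hα1
      (measurable_const.sub (v.continuous.comp (continuous_sub_left x)).measurable) (hK x)
  · have hΓ : Real.Gamma (1 - α) ≠ 0 := (Real.Gamma_pos_of_pos (by linarith)).ne'
    have hc : ((α / Real.Gamma (1 - α) : ℝ) : ℂ) * ((Real.Gamma (1 - α) / α : ℝ) : ℂ) = 1 := by
      rw [← Complex.ofReal_mul, ← Complex.ofReal_one]
      congr 1
      field_simp
    simp only [marchaud, mul_assoc (((α / Real.Gamma (1 - α) : ℝ) : ℂ)), ← integral_mul_const,
      integral_const_mul]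
    rw [integral_integral_swap (integrable_marchaud_integrand_prod hα hα1 v ξ)]
    simp only [mul_right_comm _ _ (Complex.exp _), integral_mul_const,
      integral_sub_comp_sub_mul_exp, mul_right_comm _ (∫ x, _)]
    rw [← oneSubExpIntegral, oneSubExpIntegral_I_mul hα hα1]
    linear_combination (Real.sqrt (2 * Real.pi) : ℂ)⁻¹ * (Complex.I * (ξ : ℂ)) ^ (α : ℂ) *
      (∫ x : ℝ, v x * Complex.exp (-(Complex.I * (ξ : ℂ) * (x : ℂ)))) * hc
end
end

section
/- Let 0 < α < 1 and λ > 0. Then the causal Mittag-Leffler kernel g(s) := s^{α−1} E_{α,α}(−λ s^α) for s > 0 (and g(s) := 0 for s ≤ 0) is integrable on ℝ, i.e. ∫_0^∞ s^{α−1} |E_{α,α}(−λ s^α)| ds < ∞. -/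
open MeasureTheory Set Filter

noncomputable section

/-- The two-parameter Mittag-Leffler function (real argument). -/
def mlE (α β x : ℝ) : ℝ := ∑' k : ℕ, x ^ k / Real.Gamma (α * k + β)

open Topology

theorem multichoose_eq_eval (s : ℝ) (n : ℕ) :
    Ring.multichoose s n = ((n.factorial : ℝ)⁻¹) * (ascPochhammer ℝ n).eval s := by
  have h := Ring.factorial_nsmul_multichoose_eq_ascPochhammer s n
  rw [Polynomial.ascPochhammer_smeval_eq_eval, nsmul_eq_mul] at h
  rw [← h, inv_mul_cancel_left₀ (by positivity)]

theorem multichoose_succ_right (s : ℝ) (n : ℕ) :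
    Ring.multichoose s (n + 1) = (s + n) / (n + 1) * Ring.multichoose s n := by
  rw [multichoose_eq_eval, multichoose_eq_eval, ascPochhammer_succ_eval, Nat.factorial_succ]
  push_cast
  field_simp

theorem add_natCast_mul_multichoose (s : ℝ) (n : ℕ) :
    (s + n) * Ring.multichoose s n = s * Ring.multichoose (s + 1) n := by
  induction n with
  | zero => simp
  | succ n ih =>
    rw [multichoose_succ_right, multichoose_succ_right, mul_left_comm s, ← ih]
    push_cast
    field_simp
    ring

theorem multichoose_add (r s : ℝ) (n : ℕ) :
    Ring.multichoose (r + s) n =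
      ∑ ij ∈ Finset.HasAntidiagonal.antidiagonal n, Ring.multichoose r ij.1 * Ring.multichoose s ij.2 := by
  have key (t : ℝ) (m : ℕ) : Ring.multichoose t m = (-1) ^ m * Ring.choose (-t) m := by
    rw [Ring.choose_neg', Units.smul_def, zsmul_eq_mul, ← mul_assoc]
    have : ((m : ℤ).negOnePow : ℤ) = (-1) ^ m := by simp [Int.negOnePow_def]
    simp [this, ← mul_pow]
  rw [key, neg_add, Ring.add_choose_eq n (Commute.all _ _), Finset.mul_sum]
  refine Finset.sum_congr rfl fun ij hij => ?_
  rw [key, key, ← Finset.HasAntidiagonal.mem_antidiagonal.mp hij, pow_add]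
  ring

theorem multichoose_nonneg {s : ℝ} (hs : 0 ≤ s) (n : ℕ) : 0 ≤ Ring.multichoose s n := by
  induction n with
  | zero => simp
  | succ n ih => rw [multichoose_succ_right]; positivity

theorem multichoose_succ_nonpos {s : ℝ} (hs : -1 ≤ s) (hs0 : s ≤ 0) (n : ℕ) :
    Ring.multichoose s (n + 1) ≤ 0 := by
  induction n with
  | zero => simpa using hs0
  | succ n ih =>
    rw [multichoose_succ_right]
    refine mul_nonpos_of_nonneg_of_nonpos (div_nonneg ?_ (by positivity)) ih
    push_cast
    linarith [(n.cast_nonneg : (0 : ℝ) ≤ n)]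

theorem multichoose_mul_rpow_antitone {s : ℝ} (hs : 1 ≤ s) {N n : ℕ} (hN : 1 ≤ N) (hn : N ≤ n) :
    Ring.multichoose s n * (n : ℝ) ^ (1 - s) ≤ Ring.multichoose s N * (N : ℝ) ^ (1 - s) := by
  induction n, hn using Nat.le_induction with
  | base => rfl
  | succ n hn ih =>
    refine le_trans ?_ ih
    have hn0 : (0 : ℝ) < n := by exact_mod_cast hN.trans hn
    have hb : (s + n) / (n + 1) ≤ ((n + 1 : ℝ) / n) ^ (s - 1) := by
      have h1 : (s + n) / (n + 1) = (s - 1) * (1 / (n + 1 : ℝ)) + 1 := by field_simp; ring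
      have hlog : 1 / (n + 1 : ℝ) ≤ Real.log ((n + 1 : ℝ) / n) := by
        have := Real.one_sub_inv_le_log_of_pos (x := (n + 1 : ℝ) / n) (by positivity)
        refine le_trans (le_of_eq ?_) this
        field_simp
        ring
      rw [h1, Real.rpow_def_of_pos (by positivity), mul_comm (Real.log _)]
      refine (Real.add_one_le_exp _).trans (Real.exp_le_exp.2 ?_)
      exact mul_le_mul_of_nonneg_left hlog (by linarith)
    rw [multichoose_succ_right, Nat.cast_succ]
    have hm := multichoose_nonneg (by linarith : 0 ≤ s) n
    have h2 : ((n + 1 : ℝ) / n) ^ (s - 1) * (n + 1 : ℝ) ^ (1 - s) = (n : ℝ) ^ (1 - s) := by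
      rw [← neg_sub s 1, Real.rpow_neg (by positivity), Real.rpow_neg (by positivity),
        Real.div_rpow (by positivity) (by positivity)]
      field_simp
    calc (s + n) / (n + 1) * Ring.multichoose s n * (n + 1 : ℝ) ^ (1 - s)
        ≤ ((n + 1 : ℝ) / n) ^ (s - 1) * Ring.multichoose s n * (n + 1 : ℝ) ^ (1 - s) := by gcongr
      _ = Ring.multichoose s n * (((n + 1 : ℝ) / n) ^ (s - 1) * (n + 1 : ℝ) ^ (1 - s)) := by ring
      _ = _ := by rw [h2]

theorem multichoose_mul_rpow_le {s : ℝ} (hs : 0 ≤ s) {N n : ℕ} (hN : 1 ≤ N) (hn : N ≤ n) :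
    Ring.multichoose s n * (n : ℝ) ^ (1 - s) ≤
      s * Ring.multichoose (s + 1) N * (N : ℝ) ^ (-s) := by
  have hn0 : (0 : ℝ) < n := by exact_mod_cast hN.trans hn
  have h := multichoose_mul_rpow_antitone (s := s + 1) (by linarith) hN hn
  have he : 1 - (s + 1) = -s := by ring
  rw [he] at h
  calc Ring.multichoose s n * (n : ℝ) ^ (1 - s)
      = n * Ring.multichoose s n * (n : ℝ) ^ (-s) := by
        rw [sub_eq_add_neg, Real.rpow_add hn0, Real.rpow_one]; ring
    _ ≤ (s + n) * Ring.multichoose s n * (n : ℝ) ^ (-s) := by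
        have := multichoose_nonneg hs n
        gcongr
        linarith
    _ = s * (Ring.multichoose (s + 1) n * (n : ℝ) ^ (-s)) := by
        rw [add_natCast_mul_multichoose]; ring
    _ ≤ s * (Ring.multichoose (s + 1) N * (N : ℝ) ^ (-s)) := by gcongr
    _ = _ := by ring

theorem tendsto_multichoose_mul_rpow {s : ℝ} (hs : 0 < s) :
    Tendsto (fun n : ℕ => Ring.multichoose s n * (n : ℝ) ^ (1 - s)) atTop
      (𝓝 (Real.Gamma s)⁻¹) := by
  have h1 : Tendsto (fun n : ℕ => (n : ℝ) / (n + s)) atTop (𝓝 1) :=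
    tendsto_natCast_div_add_atTop s
  have h2 := h1.mul ((Real.GammaSeq_tendsto_Gamma s).inv₀ (Real.Gamma_pos_of_pos hs).ne')
  rw [one_mul] at h2
  refine h2.congr' ?_
  filter_upwards [eventually_ge_atTop 1] with n hn
  have hn0 : (0 : ℝ) < n := by exact_mod_cast hn
  have hp : ∀ m : ℕ, ∏ j ∈ Finset.range m, (s + j) = m.factorial * Ring.multichoose s m := by
    intro m
    induction m with
    | zero => simp
    | succ m ih =>
      rw [Finset.prod_range_succ, ih, multichoose_succ_right, Nat.factorial_succ]
      push_cast
      field_simp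
  rw [Real.GammaSeq, Finset.prod_range_succ, hp, Real.rpow_sub hn0, Real.rpow_one]
  have := Real.rpow_pos_of_pos hn0 s
  field_simp
  ring

theorem summable_polynomial_eval_mul_pow (p : Polynomial ℝ) {q : ℝ} (hq : ‖q‖ < 1) :
    Summable fun k : ℕ => p.eval (k : ℝ) * q ^ k := by
  induction p using Polynomial.induction_on' with
  | add p r hp hr => simpa [add_mul] using hp.add hr
  | monomial n a =>
    simpa [mul_assoc] using (summable_pow_mul_geometric_of_norm_lt_one n hq).mul_left a

theorem summable_pow_mul_multichoose (α β : ℝ) (n : ℕ) {q : ℝ} (hq : ‖q‖ < 1) :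
    Summable fun k : ℕ => q ^ k * Ring.multichoose (α * k + β) n := by
  have h := (summable_polynomial_eval_mul_pow ((ascPochhammer ℝ n).comp
    (Polynomial.C α * Polynomial.X + Polynomial.C β)) hq).mul_left (n.factorial : ℝ)⁻¹
  refine h.congr fun k => ?_
  simp only [multichoose_eq_eval, Polynomial.eval_comp, Polynomial.eval_add, Polynomial.eval_mul,
    Polynomial.eval_C, Polynomial.eval_X]
  ring

/-- The coefficient of `z ^ n` in `(1 - z) ^ (α - β) / ((1 - z) ^ α + μ)`. -/
def resolventCoeff (α β μ : ℝ) (n : ℕ) : ℝ :=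
  ∑' k : ℕ, (-μ) ^ k * Ring.multichoose (α * k + β) n

theorem sum_multichoose_mul_resolventCoeff (α β γ : ℝ) {μ : ℝ} (hμ : ‖-μ‖ < 1) (n : ℕ) :
    ∑ ij ∈ Finset.HasAntidiagonal.antidiagonal n, Ring.multichoose γ ij.1 * resolventCoeff α β μ ij.2 =
      resolventCoeff α (γ + β) μ n := by
  have h := Summable.tsum_finsetSum (s := Finset.HasAntidiagonal.antidiagonal n)
    (f := fun (ij : ℕ × ℕ) (k : ℕ) =>
      Ring.multichoose γ ij.1 * ((-μ) ^ k * Ring.multichoose (α * k + β) ij.2))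
    fun ij _ => (summable_pow_mul_multichoose α β ij.2 hμ).mul_left (Ring.multichoose γ ij.1)
  simp only [tsum_mul_left] at h
  refine h.symm.trans (tsum_congr fun k => ?_)
  rw [show α * k + (γ + β) = γ + (α * k + β) by ring, multichoose_add, Finset.mul_sum]
  exact Finset.sum_congr rfl fun ij _ => by ring

theorem resolventCoeff_zero (α : ℝ) {μ : ℝ} (hμ : ‖-μ‖ < 1) (n : ℕ) :
    resolventCoeff α 0 μ n = Ring.multichoose 0 n - μ * resolventCoeff α α μ n := by
  rw [resolventCoeff, (summable_pow_mul_multichoose α 0 n hμ).tsum_eq_zero_add, resolventCoeff,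
    sub_eq_add_neg, ← neg_mul, ← tsum_mul_left]
  congr 1
  · simp
  · refine tsum_congr fun k => ?_
    rw [pow_succ, Nat.cast_succ, add_zero, mul_add, mul_one]
    ring

theorem resolventCoeff_self_nonneg {α μ : ℝ} (hα : 0 ≤ α) (hα1 : α ≤ 1) (hμ0 : 0 ≤ μ)
    (hμ : ‖-μ‖ < 1) (n : ℕ) : 0 ≤ resolventCoeff α α μ n := by
  induction n using Nat.strong_induction_on with
  | _ n ih =>
    have h := sum_multichoose_mul_resolventCoeff α α (-α) hμ n
    rw [neg_add_cancel, resolventCoeff_zero α hμ] at h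
    cases n with
    | zero =>
      simp at h
      nlinarith
    | succ n =>
      rw [Finset.Nat.sum_antidiagonal_succ, Ring.multichoose_zero_succ] at h
      have hs : ∑ ij ∈ Finset.HasAntidiagonal.antidiagonal n,
          Ring.multichoose (-α) (ij.1 + 1) * resolventCoeff α α μ ij.2 ≤ 0 := by
        refine Finset.sum_nonpos fun ij hij => mul_nonpos_of_nonpos_of_nonneg
          (multichoose_succ_nonpos (by linarith) (by linarith) _) (ih _ ?_)
        have := Finset.HasAntidiagonal.mem_antidiagonal.mp hij
        omega
      simp at h
      nlinarith

theorem resolventCoeff_nonneg {α β μ : ℝ} (hα : 0 ≤ α) (hα1 : α ≤ 1) (hβ : α ≤ β) (hμ0 : 0 ≤ μ)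
    (hμ : ‖-μ‖ < 1) (n : ℕ) : 0 ≤ resolventCoeff α β μ n := by
  rw [← sub_add_cancel β α, ← sum_multichoose_mul_resolventCoeff α α (β - α) hμ n]
  exact Finset.sum_nonneg fun ij _ => mul_nonneg (multichoose_nonneg (sub_nonneg.2 hβ) _)
    (resolventCoeff_self_nonneg hα hα1 hμ0 hμ _)

theorem exists_summable_bound {α : ℝ} (hα : 0 < α) (β x : ℝ) :
    ∃ N : ℕ, 1 ≤ N ∧ ‖x * (N : ℝ) ^ (-α)‖ < 1 ∧ Summable fun k : ℕ => |x| ^ k *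
      ((α * k + β) * Ring.multichoose (α * k + β + 1) N * (N : ℝ) ^ (-(α * k + β))) := by
  have ht : Tendsto (fun N : ℕ => ‖x * (N : ℝ) ^ (-α)‖) atTop (𝓝 0) := by
    have := (((tendsto_rpow_neg_atTop hα).comp tendsto_natCast_atTop_atTop).const_mul x).norm
    simpa using this
  obtain ⟨N, hN, hN1⟩ := ((ht.eventually_lt_const one_pos).and (eventually_ge_atTop 1)).exists
  refine ⟨N, hN1, hN, ?_⟩
  have hN0 : (0 : ℝ) < N := by exact_mod_cast hN1
  set p : Polynomial ℝ := Polynomial.C α * Polynomial.X + Polynomial.C β with hp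
  have h := (summable_polynomial_eval_mul_pow (p * (ascPochhammer ℝ N).comp (p + 1))
    (q := ‖x * (N : ℝ) ^ (-α)‖) (by simpa using hN)).mul_left
      ((N.factorial : ℝ)⁻¹ * (N : ℝ) ^ (-β))
  refine h.congr fun k => ?_
  simp only [hp, multichoose_eq_eval, Polynomial.eval_comp, Polynomial.eval_add,
    Polynomial.eval_mul, Polynomial.eval_C, Polynomial.eval_X, Polynomial.eval_one]
  rw [norm_mul, Real.norm_eq_abs, Real.norm_of_nonneg (by positivity), mul_pow, neg_add,
    Real.rpow_add hN0, ← neg_mul, Real.rpow_mul hN0.le, Real.rpow_natCast]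
  ring

theorem inv_Gamma_le {s : ℝ} (hs : 0 < s) {N : ℕ} (hN : 1 ≤ N) :
    (Real.Gamma s)⁻¹ ≤ s * Ring.multichoose (s + 1) N * (N : ℝ) ^ (-s) :=
  le_of_tendsto (tendsto_multichoose_mul_rpow hs)
    ((eventually_ge_atTop N).mono fun _ hn => multichoose_mul_rpow_le hs.le hN hn)

theorem summable_mlE {α β : ℝ} (hα : 0 < α) (hβ : 0 < β) (x : ℝ) :
    Summable fun k : ℕ => x ^ k / Real.Gamma (α * k + β) := by
  obtain ⟨N, hN, -, hs⟩ := exists_summable_bound hα β x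
  refine Summable.of_norm_bounded hs fun k => ?_
  have hk : 0 < α * k + β := by positivity
  rw [div_eq_mul_inv, norm_mul, norm_pow, Real.norm_eq_abs,
    Real.norm_of_nonneg (inv_nonneg.2 (Real.Gamma_pos_of_pos hk).le)]
  gcongr
  exact inv_Gamma_le hk hN

theorem mlE_neg_nonneg {α β x : ℝ} (hα : 0 < α) (hα1 : α ≤ 1) (hβ : α ≤ β) (hx : 0 ≤ x) :
    0 ≤ mlE α β (-x) := by
  have hβ0 : 0 < β := hα.trans_le hβ
  obtain ⟨N, hN, hNx, hs⟩ := exists_summable_bound hα β (-x)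
  have hlim : Tendsto (fun n : ℕ => ∑' k : ℕ, (-x) ^ k *
      (Ring.multichoose (α * k + β) n * (n : ℝ) ^ (1 - (α * k + β)))) atTop
      (𝓝 (mlE α β (-x))) := by
    refine tendsto_tsum_of_dominated_convergence hs (fun k => ?_) ?_
    · rw [div_eq_mul_inv]
      exact (tendsto_multichoose_mul_rpow (by positivity)).const_mul _
    · filter_upwards [eventually_ge_atTop N] with n hn k
      have hk : 0 < α * k + β := by positivity
      rw [norm_mul, norm_pow, Real.norm_eq_abs, Real.norm_of_nonneg
        (mul_nonneg (multichoose_nonneg hk.le n) (by positivity))]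
      exact mul_le_mul_of_nonneg_left (multichoose_mul_rpow_le hk.le hN hn) (by positivity)
  refine ge_of_tendsto hlim ?_
  filter_upwards [eventually_ge_atTop N] with n hn
  have hN0 : (0 : ℝ) < N := by exact_mod_cast hN
  have hn0 : (0 : ℝ) < n := by exact_mod_cast hN.trans hn
  have hμ : ‖-(x * (n : ℝ) ^ (-α))‖ < 1 := by
    refine lt_of_le_of_lt ?_ hNx
    rw [neg_mul, norm_neg, norm_neg, Real.norm_of_nonneg (by positivity),
      Real.norm_of_nonneg (by positivity)]
    refine mul_le_mul_of_nonneg_left ?_ hx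
    exact Real.rpow_le_rpow_of_nonpos hN0 (by exact_mod_cast hn) (by linarith)
  have heq : ∑' k : ℕ, (-x) ^ k *
      (Ring.multichoose (α * k + β) n * (n : ℝ) ^ (1 - (α * k + β))) =
      (n : ℝ) ^ (1 - β) * resolventCoeff α β (x * (n : ℝ) ^ (-α)) n := by
    rw [resolventCoeff, ← tsum_mul_left]
    refine tsum_congr fun k => ?_
    rw [show 1 - (α * k + β) = (1 - β) + -α * k by ring, Real.rpow_add hn0,
      Real.rpow_mul hn0.le, Real.rpow_natCast, ← neg_mul, mul_pow]
    ring
  rw [heq]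
  exact mul_nonneg (by positivity) (resolventCoeff_nonneg hα.le hα1 hβ (by positivity) hμ n)

theorem hasDerivAt_mlE_one {α : ℝ} (hα : 0 < α) (x : ℝ) :
    HasDerivAt (mlE α 1) (mlE α α x / α) x := by
  have hu : Summable fun k : ℕ => (|x| + 1) ^ k / Real.Gamma (α * k + α) / α :=
    (summable_mlE hα hα _).div_const α
  have hG (k : ℕ) : Real.Gamma (α * (k + 1 : ℕ) + 1) =
      α * (k + 1) * Real.Gamma (α * k + α) := by
    rw [Real.Gamma_add_one (by positivity)]
    push_cast
    rw [mul_add, mul_one]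
  have hmem : x ∈ Metric.ball (0 : ℝ) (|x| + 1) := by simp
  have h := hasDerivAt_tsum_of_isPreconnected (𝕜 := ℝ) hu Metric.isOpen_ball
    (convex_ball (0 : ℝ) (|x| + 1)).isPreconnected
    (g := fun (k : ℕ) y => y ^ (k + 1) / Real.Gamma (α * (k + 1 : ℕ) + 1))
    (g' := fun k y => y ^ k / Real.Gamma (α * k + α) / α) (y₀ := x) (y := x)
    (fun k y _ => by
      have hpos : 0 < Real.Gamma (α * k + α) := Real.Gamma_pos_of_pos (by positivity)
      have := (hasDerivAt_pow (k + 1) y).div_const (Real.Gamma (α * (k + 1 : ℕ) + 1))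
      convert! this using 1
      rw [hG]
      push_cast
      field_simp)
    (fun k y hy => by
      have hpos : 0 < Real.Gamma (α * k + α) := Real.Gamma_pos_of_pos (by positivity)
      rw [norm_div, norm_div, norm_pow, Real.norm_of_nonneg hpos.le, Real.norm_of_nonneg hα.le]
      gcongr
      simpa using (mem_ball_zero_iff.mp hy).le)
    hmem ((summable_nat_add_iff 1).2 (summable_mlE hα one_pos x)) hmem
  have hfun : mlE α 1 = fun y => (Real.Gamma 1)⁻¹ +
      ∑' k : ℕ, y ^ (k + 1) / Real.Gamma (α * (k + 1 : ℕ) + 1) := by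
    funext y
    rw [mlE, (summable_mlE hα one_pos y).tsum_eq_zero_add]
    simp
  rw [hfun, mlE, ← tsum_div_const]
  exact h.const_add _

theorem exists_tendsto_mlE_one_neg {α : ℝ} (hα : 0 < α) (hα1 : α ≤ 1) :
    ∃ l, Tendsto (fun y => mlE α 1 (-y)) atTop (𝓝 l) := by
  have hmono : MonotoneOn (mlE α 1) (Iic 0) := by
    refine monotoneOn_of_deriv_nonneg (convex_Iic 0)
      (fun x _ => (hasDerivAt_mlE_one hα x).continuousAt.continuousWithinAt)
      (fun x _ => (hasDerivAt_mlE_one hα x).differentiableAt.differentiableWithinAt) fun x hx => ?_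
    rw [(hasDerivAt_mlE_one hα x).deriv]
    have h := mlE_neg_nonneg hα hα1 le_rfl (neg_nonneg.2 (mem_Iic.1 (interior_subset hx)))
    rw [neg_neg] at h
    positivity
  have hanti : Antitone fun y : ℝ => mlE α 1 (-max y 0) := fun y z hyz =>
    hmono (by simp) (by simp) (neg_le_neg (max_le_max_right 0 hyz))
  refine ⟨_, (tendsto_atTop_ciInf hanti ⟨0, ?_⟩).congr' ?_⟩
  · rintro _ ⟨y, rfl⟩
    exact mlE_neg_nonneg hα hα1 hα1 (le_max_right y 0)
  · filter_upwards [eventually_ge_atTop 0] with y hy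
    rw [max_eq_left hy]

theorem stmt_13
    (α lam : ℝ) (hα : 0 < α) (hα1 : α < 1) (hlam : 0 < lam) :
    IntegrableOn (fun s : ℝ => s ^ (α - 1) * |mlE α α (-(lam * s ^ α))|) (Set.Ioi (0 : ℝ)) := by
  obtain ⟨l, hl⟩ := exists_tendsto_mlE_one_neg hα hα1.le
  have hnonneg : ∀ s ∈ Ioi (0 : ℝ), 0 ≤ mlE α α (-(lam * s ^ α)) := fun s hs =>
    mlE_neg_nonneg hα hα1.le le_rfl (mul_nonneg hlam.le (Real.rpow_nonneg (le_of_lt hs) α))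
  have hint : IntegrableOn (fun s : ℝ => s ^ (α - 1) * mlE α α (-(lam * s ^ α))) (Ioi 0) := by
    refine integrableOn_Ioi_deriv_of_nonneg (l := -lam⁻¹ * l)
      (g := fun s => -lam⁻¹ * mlE α 1 (-(lam * s ^ α))) ?_ (fun s hs => ?_) (fun s hs => ?_) ?_
    · have hc : Continuous (mlE α 1) :=
        continuous_iff_continuousAt.2 fun x => (hasDerivAt_mlE_one hα x).continuousAt
      have := Real.continuous_rpow_const hα.le
      exact Continuous.continuousWithinAt (by fun_prop)
    · have h := ((hasDerivAt_mlE_one hα _).comp s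
        ((Real.hasDerivAt_rpow_const (p := α) (Or.inl (ne_of_gt hs))).const_mul lam).neg).const_mul
          (-lam⁻¹)
      convert! h using 1
      simp only [Pi.neg_apply]
      field_simp
    · exact mul_nonneg (Real.rpow_nonneg (le_of_lt hs) _) (hnonneg s hs)
    · exact (hl.comp ((tendsto_rpow_atTop hα).const_mul_atTop hlam)).const_mul _
  exact hint.congr_fun (fun s hs => by rw [abs_of_nonneg (hnonneg s hs)]) measurableSet_Ioi
end
end
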